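/- arXiv:1709.01368 — 4 statements merged into one kernel-verified Lean document; each statement's English description precedes it below -/
import Mathlib

section
/- Let (x*, y*) ∈ Z and let (x^k, y^k) ⊆ Z be a sequence of M-stationary points of the continuous reformulation converging to (x*, y*). If CC-MFCQ holds at (x*, y*), then every sequence (λ^k, μ^k, γ^k) of M-stationary multipliers of (x^k, y^k) is bounded, and every accumulation point (λ*, μ*, γ*) of such a sequence is an M-stationary multiplier of (x*, y*). -/
open Set Filter Topology

noncomputable section

/-- Number of nonzero components of a vector (the "zero norm"). -/
def card0 {n : ℕ} (x : Fin n → ℝ) : ℕ := {i | x i ≠ 0}.ncard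

/-- First directional derivative `∇φ(x)ᵀd`. -/
def D1 {n : ℕ} (φ : (Fin n → ℝ) → ℝ) (x d : Fin n → ℝ) : ℝ := fderiv ℝ φ x d

/-- Second derivative quadratic form `dᵀ∇²φ(x)d`. -/
def D2 {n : ℕ} (φ : (Fin n → ℝ) → ℝ) (x d : Fin n → ℝ) : ℝ :=
  iteratedFDeriv ℝ 2 φ x ![d, d]

/-- Feasibility for the cardinality constrained problem (CCP):
`g(x) ≤ 0`, `h(x) = 0`, `‖x‖₀ ≤ κ`. -/
def CCPFeasible {n m p : ℕ} (g : (Fin n → ℝ) → Fin m → ℝ) (h : (Fin n → ℝ) → Fin p → ℝ)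
    (κ : ℕ) (x : Fin n → ℝ) : Prop :=
  (∀ i, g x i ≤ 0) ∧ (∀ i, h x i = 0) ∧ card0 x ≤ κ

/-- Feasible set `Z` of the continuous reformulation. -/
def ZSet {n m p : ℕ} (g : (Fin n → ℝ) → Fin m → ℝ) (h : (Fin n → ℝ) → Fin p → ℝ)
    (κ : ℕ) : Set ((Fin n → ℝ) × (Fin n → ℝ)) :=
  {z | (∀ i, g z.1 i ≤ 0) ∧ (∀ i, h z.1 i = 0) ∧ (∀ i, 0 ≤ z.2 i) ∧ (∀ i, z.2 i ≤ 1) ∧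
    ((n : ℝ) - (κ : ℝ) ≤ ∑ i, z.2 i) ∧ ∀ i, z.1 i * z.2 i = 0}

/-- `(lam, mu, gam)` is an M-stationary multiplier at `x`. -/
def IsMMult {n m p : ℕ} (f : (Fin n → ℝ) → ℝ) (g : (Fin n → ℝ) → Fin m → ℝ)
    (h : (Fin n → ℝ) → Fin p → ℝ) (x : Fin n → ℝ)
    (lam : Fin m → ℝ) (mu : Fin p → ℝ) (gam : Fin n → ℝ) : Prop :=
  (∀ d, D1 f x d + ∑ i, lam i * D1 (fun x' => g x' i) x d
      + ∑ i, mu i * D1 (fun x' => h x' i) x d + ∑ i, gam i * d i = 0) ∧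
  (∀ i, 0 ≤ lam i) ∧ (∀ i, lam i * g x i = 0) ∧ (∀ i, x i ≠ 0 → gam i = 0)

/-- `(lam, mu, gam)` is an S-stationary multiplier at `(x, y)`. -/
def IsSMult {n m p : ℕ} (f : (Fin n → ℝ) → ℝ) (g : (Fin n → ℝ) → Fin m → ℝ)
    (h : (Fin n → ℝ) → Fin p → ℝ) (x y : Fin n → ℝ)
    (lam : Fin m → ℝ) (mu : Fin p → ℝ) (gam : Fin n → ℝ) : Prop :=
  IsMMult f g h x lam mu gam ∧ ∀ i, x i = 0 → y i = 0 → gam i = 0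

/-- `z` is an M-stationary point of the continuous reformulation. -/
def MStationary {n m p : ℕ} (f : (Fin n → ℝ) → ℝ) (g : (Fin n → ℝ) → Fin m → ℝ)
    (h : (Fin n → ℝ) → Fin p → ℝ) (κ : ℕ) (z : (Fin n → ℝ) × (Fin n → ℝ)) : Prop :=
  z ∈ ZSet g h κ ∧ ∃ lam mu gam, IsMMult f g h z.1 lam mu gam

/-- `z` is an S-stationary point of the continuous reformulation. -/
def SStationary {n m p : ℕ} (f : (Fin n → ℝ) → ℝ) (g : (Fin n → ℝ) → Fin m → ℝ)
    (h : (Fin n → ℝ) → Fin p → ℝ) (κ : ℕ) (z : (Fin n → ℝ) × (Fin n → ℝ)) : Prop :=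
  z ∈ ZSet g h κ ∧ ∃ lam mu gam, IsSMult f g h z.1 z.2 lam mu gam

/-- CC-LICQ at `x`: the active gradients `∇gᵢ(x)` (`gᵢ(x) = 0`), all `∇hᵢ(x)`,
and the unit vectors `eᵢ` (`xᵢ = 0`) are linearly independent. -/
def CCLICQ {n m p : ℕ} (g : (Fin n → ℝ) → Fin m → ℝ) (h : (Fin n → ℝ) → Fin p → ℝ)
    (x : Fin n → ℝ) : Prop :=
  ∀ (lam : Fin m → ℝ) (mu : Fin p → ℝ) (gam : Fin n → ℝ),
    (∀ i, g x i ≠ 0 → lam i = 0) → (∀ i, x i ≠ 0 → gam i = 0) →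
    (∀ d, ∑ i, lam i * D1 (fun x' => g x' i) x d
        + ∑ i, mu i * D1 (fun x' => h x' i) x d + ∑ i, gam i * d i = 0) →
    lam = 0 ∧ mu = 0 ∧ gam = 0

/-- CC-MFCQ at `x`: the active gradients `∇gᵢ(x)` together with all `∇hᵢ(x)` and the
unit vectors `eᵢ` (`xᵢ = 0`) are positively linearly independent. -/
def CCMFCQ {n m p : ℕ} (g : (Fin n → ℝ) → Fin m → ℝ) (h : (Fin n → ℝ) → Fin p → ℝ)
    (x : Fin n → ℝ) : Prop :=
  ∀ (lam : Fin m → ℝ) (mu : Fin p → ℝ) (gam : Fin n → ℝ),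
    (∀ i, 0 ≤ lam i) → (∀ i, g x i ≠ 0 → lam i = 0) → (∀ i, x i ≠ 0 → gam i = 0) →
    (∀ d, ∑ i, lam i * D1 (fun x' => g x' i) x d
        + ∑ i, mu i * D1 (fun x' => h x' i) x d + ∑ i, gam i * d i = 0) →
    lam = 0 ∧ mu = 0 ∧ gam = 0

/-- The linear combination `Σ lamᵢ ∇gᵢ(x) + Σ muᵢ ∇hᵢ(x) + Σ gamᵢ eᵢ` vanishes. -/
def CombZero {n m p : ℕ} (g : (Fin n → ℝ) → Fin m → ℝ) (h : (Fin n → ℝ) → Fin p → ℝ)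
    (lam : Fin m → ℝ) (mu : Fin p → ℝ) (gam : Fin n → ℝ) (x : Fin n → ℝ) : Prop :=
  ∀ d, ∑ i, lam i * D1 (fun x' => g x' i) x d
      + ∑ i, mu i * D1 (fun x' => h x' i) x d + ∑ i, gam i * d i = 0

/-- CC-CPLD at `x`: whenever gradients indexed by subsets of the active sets are
positively linearly dependent at `x`, they remain linearly dependent nearby. -/
def CCCPLD {n m p : ℕ} (g : (Fin n → ℝ) → Fin m → ℝ) (h : (Fin n → ℝ) → Fin p → ℝ)
    (x : Fin n → ℝ) : Prop :=
  ∀ (I1 : Finset (Fin m)) (I2 : Finset (Fin p)) (I3 : Finset (Fin n)),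
    (∀ i ∈ I1, g x i = 0) → (∀ i ∈ I3, x i = 0) →
    (∃ lam mu gam, (∀ i, 0 ≤ lam i) ∧ (∀ i, i ∉ I1 → lam i = 0) ∧ (∀ i, i ∉ I2 → mu i = 0) ∧
      (∀ i, i ∉ I3 → gam i = 0) ∧ ¬(lam = 0 ∧ mu = 0 ∧ gam = 0) ∧ CombZero g h lam mu gam x) →
    ∀ᶠ x' in nhds x, ∃ lam mu gam, (∀ i, i ∉ I1 → lam i = 0) ∧ (∀ i, i ∉ I2 → mu i = 0) ∧
      (∀ i, i ∉ I3 → gam i = 0) ∧ ¬(lam = 0 ∧ mu = 0 ∧ gam = 0) ∧ CombZero g h lam mu gam x'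

/-- The CC-linearisation cone `L_Z(x, y)` (as a predicate on `(dx, dy)`). -/
def LinCone {n m p : ℕ} (g : (Fin n → ℝ) → Fin m → ℝ) (h : (Fin n → ℝ) → Fin p → ℝ)
    (κ : ℕ) (x y dx dy : Fin n → ℝ) : Prop :=
  (∀ i, g x i = 0 → D1 (fun x' => g x' i) x dx ≤ 0) ∧
  (∀ i, D1 (fun x' => h x' i) x dx = 0) ∧
  ((∑ i, y i = (n : ℝ) - (κ : ℝ)) → 0 ≤ ∑ i, dy i) ∧
  (∀ i, x i ≠ 0 → y i = 0 → dy i = 0) ∧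
  (∀ i, x i = 0 → y i = 0 → 0 ≤ dy i) ∧
  (∀ i, x i = 0 → y i = 1 → dy i ≤ 0) ∧
  (∀ i, x i = 0 → 0 < y i → dx i = 0) ∧
  (∀ i, x i = 0 → y i = 0 → dx i * dy i = 0)

/-- The CC-critical cone `C_Z(x, y)`. -/
def CritCone {n m p : ℕ} (f : (Fin n → ℝ) → ℝ) (g : (Fin n → ℝ) → Fin m → ℝ)
    (h : (Fin n → ℝ) → Fin p → ℝ) (κ : ℕ) (x y dx dy : Fin n → ℝ) : Prop :=
  LinCone g h κ x y dx dy ∧ D1 f x dx ≤ 0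

/-- The critical cone `C_X(x)` for the original cardinality constrained problem. -/
def CritConeX {n m p : ℕ} (f : (Fin n → ℝ) → ℝ) (g : (Fin n → ℝ) → Fin m → ℝ)
    (h : (Fin n → ℝ) → Fin p → ℝ) (κ : ℕ) (x dx : Fin n → ℝ) : Prop :=
  (∀ i, g x i = 0 → D1 (fun x' => g x' i) x dx ≤ 0) ∧
  (∀ i, D1 (fun x' => h x' i) x dx = 0) ∧
  (n - κ ≤ {i | x i = 0 ∧ dx i = 0}.ncard) ∧
  D1 f x dx ≤ 0

/-- `x` is a local minimum of the cardinality constrained problem. -/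
def LocalMinCCP {n m p : ℕ} (f : (Fin n → ℝ) → ℝ) (g : (Fin n → ℝ) → Fin m → ℝ)
    (h : (Fin n → ℝ) → Fin p → ℝ) (κ : ℕ) (x : Fin n → ℝ) : Prop :=
  CCPFeasible g h κ x ∧ ∃ r > (0 : ℝ), ∀ x', CCPFeasible g h κ x' → dist x' x < r → f x ≤ f x'

/-- `x` is a strict local minimum of the cardinality constrained problem. -/
def StrictLocalMinCCP {n m p : ℕ} (f : (Fin n → ℝ) → ℝ) (g : (Fin n → ℝ) → Fin m → ℝ)
    (h : (Fin n → ℝ) → Fin p → ℝ) (κ : ℕ) (x : Fin n → ℝ) : Prop :=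
  CCPFeasible g h κ x ∧
    ∃ r > (0 : ℝ), ∀ x', CCPFeasible g h κ x' → dist x' x < r → x' ≠ x → f x < f x'

/-- `z` is a local minimum of the continuous reformulation. -/
def LocalMinZ {n m p : ℕ} (f : (Fin n → ℝ) → ℝ) (g : (Fin n → ℝ) → Fin m → ℝ)
    (h : (Fin n → ℝ) → Fin p → ℝ) (κ : ℕ) (z : (Fin n → ℝ) × (Fin n → ℝ)) : Prop :=
  z ∈ ZSet g h κ ∧ ∃ r > (0 : ℝ), ∀ z' ∈ ZSet g h κ, dist z' z < r → f z.1 ≤ f z'.1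

/-- `z` is a strict local minimum with respect to `x` of the continuous reformulation. -/
def StrictLocalMinX {n m p : ℕ} (f : (Fin n → ℝ) → ℝ) (g : (Fin n → ℝ) → Fin m → ℝ)
    (h : (Fin n → ℝ) → Fin p → ℝ) (κ : ℕ) (z : (Fin n → ℝ) × (Fin n → ℝ)) : Prop :=
  z ∈ ZSet g h κ ∧
    ∃ r > (0 : ℝ), ∀ z' ∈ ZSet g h κ, dist z' z < r → z'.1 ≠ z.1 → f z.1 < f z'.1

/-- Feasible set `Z(t)` of the Scholtes-type regularized program NLP(t). -/
def ZReg {n m p : ℕ} (g : (Fin n → ℝ) → Fin m → ℝ) (h : (Fin n → ℝ) → Fin p → ℝ)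
    (κ : ℕ) (t : ℝ) : Set ((Fin n → ℝ) × (Fin n → ℝ)) :=
  {z | (∀ i, g z.1 i ≤ 0) ∧ (∀ i, h z.1 i = 0) ∧ (∀ i, 0 ≤ z.2 i) ∧ (∀ i, z.2 i ≤ 1) ∧
    ((n : ℝ) - (κ : ℝ) ≤ ∑ i, z.2 i) ∧ (∀ i, z.1 i * z.2 i ≤ t) ∧ ∀ i, -t ≤ z.1 i * z.2 i}

/-- `z` is a local minimum of the regularized program NLP(t). -/
def LocalMinReg {n m p : ℕ} (f : (Fin n → ℝ) → ℝ) (g : (Fin n → ℝ) → Fin m → ℝ)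
    (h : (Fin n → ℝ) → Fin p → ℝ) (κ : ℕ) (t : ℝ) (z : (Fin n → ℝ) × (Fin n → ℝ)) : Prop :=
  z ∈ ZReg g h κ t ∧ ∃ r > (0 : ℝ), ∀ z' ∈ ZReg g h κ t, dist z' z < r → f z.1 ≤ f z'.1

/-- `z` is a KKT point of the regularized program NLP(t). -/
def KKTReg {n m p : ℕ} (f : (Fin n → ℝ) → ℝ) (g : (Fin n → ℝ) → Fin m → ℝ)
    (h : (Fin n → ℝ) → Fin p → ℝ) (κ : ℕ) (t : ℝ) (z : (Fin n → ℝ) × (Fin n → ℝ)) : Prop :=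
  z ∈ ZReg g h κ t ∧
  ∃ (lam : Fin m → ℝ) (mu : Fin p → ℝ) (nu0 nu1 : Fin n → ℝ) (rho : ℝ) (dpl dmi : Fin n → ℝ),
    (∀ d : Fin n → ℝ, D1 f z.1 d + ∑ i, lam i * D1 (fun x' => g x' i) z.1 d
        + ∑ i, mu i * D1 (fun x' => h x' i) z.1 d
        + ∑ i, (dpl i - dmi i) * z.2 i * d i = 0) ∧
    (∀ i, -nu0 i + nu1 i - rho + (dpl i - dmi i) * z.1 i = 0) ∧
    (∀ i, 0 ≤ lam i) ∧ (∀ i, 0 ≤ nu0 i) ∧ (∀ i, 0 ≤ nu1 i) ∧ 0 ≤ rho ∧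
    (∀ i, 0 ≤ dpl i) ∧ (∀ i, 0 ≤ dmi i) ∧
    (∀ i, lam i * g z.1 i = 0) ∧ (∀ i, nu0 i * z.2 i = 0) ∧ (∀ i, nu1 i * (z.2 i - 1) = 0) ∧
    rho * (∑ i, z.2 i - ((n : ℝ) - (κ : ℝ))) = 0 ∧
    (∀ i, dpl i * (z.1 i * z.2 i - t) = 0) ∧ (∀ i, dmi i * (z.1 i * z.2 i + t) = 0)

/-- Standard MFCQ for the regularized program NLP(t) at a feasible point `z`. -/
def MFCQReg {n m p : ℕ} (g : (Fin n → ℝ) → Fin m → ℝ) (h : (Fin n → ℝ) → Fin p → ℝ)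
    (κ : ℕ) (t : ℝ) (z : (Fin n → ℝ) × (Fin n → ℝ)) : Prop :=
  (∀ mu : Fin p → ℝ, (∀ d, ∑ i, mu i * D1 (fun x' => h x' i) z.1 d = 0) → mu = 0) ∧
  ∃ dx dy : Fin n → ℝ,
    (∀ i, D1 (fun x' => h x' i) z.1 dx = 0) ∧
    (∀ i, g z.1 i = 0 → D1 (fun x' => g x' i) z.1 dx < 0) ∧
    (∀ i, z.2 i = 0 → 0 < dy i) ∧
    (∀ i, z.2 i = 1 → dy i < 0) ∧
    (∑ i, z.2 i = (n : ℝ) - (κ : ℝ) → 0 < ∑ i, dy i) ∧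
    (∀ i, z.1 i * z.2 i = t → z.2 i * dx i + z.1 i * dy i < 0) ∧
    (∀ i, z.1 i * z.2 i = -t → 0 < z.2 i * dx i + z.1 i * dy i)

/-- Fritz John multipliers: the M-stationarity conditions with the objective gradient weighted
by `c`. -/
def IsFritzJohnMult {n m p : ℕ} (f : (Fin n → ℝ) → ℝ) (g : (Fin n → ℝ) → Fin m → ℝ)
    (h : (Fin n → ℝ) → Fin p → ℝ) (x : Fin n → ℝ) (c : ℝ)
    (w : (Fin m → ℝ) × (Fin p → ℝ) × (Fin n → ℝ)) : Prop :=
  (∀ d, c * D1 f x d + ∑ i, w.1 i * D1 (fun x' => g x' i) x d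
      + ∑ i, w.2.1 i * D1 (fun x' => h x' i) x d + ∑ i, w.2.2 i * d i = 0) ∧
  (∀ i, 0 ≤ w.1 i) ∧ (∀ i, w.1 i * g x i = 0) ∧ (∀ i, x i ≠ 0 → w.2.2 i = 0)

theorem isFritzJohnMult_one_iff {n m p : ℕ} {f : (Fin n → ℝ) → ℝ} {g : (Fin n → ℝ) → Fin m → ℝ}
    {h : (Fin n → ℝ) → Fin p → ℝ} {x : Fin n → ℝ} {w : (Fin m → ℝ) × (Fin p → ℝ) × (Fin n → ℝ)} :
    IsFritzJohnMult f g h x 1 w ↔ IsMMult f g h x w.1 w.2.1 w.2.2 := by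
  simp [IsFritzJohnMult, IsMMult]

theorem IsFritzJohnMult.smul {n m p : ℕ} {f : (Fin n → ℝ) → ℝ} {g : (Fin n → ℝ) → Fin m → ℝ}
    {h : (Fin n → ℝ) → Fin p → ℝ} {x : Fin n → ℝ} {c : ℝ}
    {w : (Fin m → ℝ) × (Fin p → ℝ) × (Fin n → ℝ)} (hw : IsFritzJohnMult f g h x c w)
    {t : ℝ} (ht : 0 ≤ t) : IsFritzJohnMult f g h x (t * c) (t • w) := by
  obtain ⟨h1, h2, h3, h4⟩ := hw
  refine ⟨fun d => ?_, fun i => mul_nonneg ht (h2 i), fun i => ?_, fun i hi => ?_⟩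
  · simp only [Prod.smul_fst, Prod.smul_snd, Pi.smul_apply, smul_eq_mul, mul_assoc,
      ← Finset.mul_sum, ← mul_add, h1 d, mul_zero]
  · simp [mul_assoc, h3 i]
  · simp [h4 i hi]

theorem CCMFCQ.eq_zero_of_isFritzJohnMult {n m p : ℕ} {f : (Fin n → ℝ) → ℝ}
    {g : (Fin n → ℝ) → Fin m → ℝ} {h : (Fin n → ℝ) → Fin p → ℝ} {x : Fin n → ℝ}
    (hx : CCMFCQ g h x) {w : (Fin m → ℝ) × (Fin p → ℝ) × (Fin n → ℝ)}
    (hw : IsFritzJohnMult f g h x 0 w) : w = 0 := by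
  obtain ⟨h1, h2, h3, h4⟩ := hw
  obtain ⟨hl, hm, hg⟩ := hx w.1 w.2.1 w.2.2 h2
    (fun i hi => (mul_eq_zero.1 (h3 i)).resolve_right hi) h4 fun d => by simpa using h1 d
  exact Prod.ext hl (Prod.ext hm hg)

theorem continuous_D1 {n : ℕ} {φ : (Fin n → ℝ) → ℝ} (hφ : ContDiff ℝ 1 φ) (d : Fin n → ℝ) :
    Continuous fun x => D1 φ x d :=
  (hφ.continuous_fderiv one_ne_zero).clm_apply continuous_const

theorem IsFritzJohnMult.of_tendsto {n m p : ℕ} {f : (Fin n → ℝ) → ℝ}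
    {g : (Fin n → ℝ) → Fin m → ℝ} {h : (Fin n → ℝ) → Fin p → ℝ}
    (hf : ContDiff ℝ 1 f) (hg : ∀ i, ContDiff ℝ 1 (fun x => g x i))
    (hh : ∀ i, ContDiff ℝ 1 (fun x => h x i)) {ι : Type*} {l : Filter ι} [l.NeBot]
    {x : ι → Fin n → ℝ} {c : ι → ℝ} {w : ι → (Fin m → ℝ) × (Fin p → ℝ) × (Fin n → ℝ)}
    {x₀ : Fin n → ℝ} {c₀ : ℝ} {w₀ : (Fin m → ℝ) × (Fin p → ℝ) × (Fin n → ℝ)}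
    (hx : Tendsto x l (𝓝 x₀)) (hc : Tendsto c l (𝓝 c₀)) (hw : Tendsto w l (𝓝 w₀))
    (hFJ : ∀ k, IsFritzJohnMult f g h (x k) (c k) (w k)) :
    IsFritzJohnMult f g h x₀ c₀ w₀ := by
  have hl (i) : Tendsto (fun k => (w k).1 i) l (𝓝 (w₀.1 i)) := hw.fst_nhds.apply_nhds i
  have hm (i) : Tendsto (fun k => (w k).2.1 i) l (𝓝 (w₀.2.1 i)) :=
    hw.snd_nhds.fst_nhds.apply_nhds i
  have hγ (i) : Tendsto (fun k => (w k).2.2 i) l (𝓝 (w₀.2.2 i)) :=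
    hw.snd_nhds.snd_nhds.apply_nhds i
  have hD {φ : (Fin n → ℝ) → ℝ} (hφ : ContDiff ℝ 1 φ) (d : Fin n → ℝ) :
      Tendsto (fun k => D1 φ (x k) d) l (𝓝 (D1 φ x₀ d)) :=
    ((continuous_D1 hφ d).tendsto x₀).comp hx
  refine ⟨fun d => ?_, fun i => ?_, fun i => ?_, fun i hi => ?_⟩
  · refine tendsto_nhds_unique (l := l) ?_
      (tendsto_const_nhds.congr fun k => ((hFJ k).1 d).symm)
    exact (((hc.mul (hD hf d)).add
      (tendsto_finsetSum _ fun i _ => (hl i).mul (hD (hg i) d))).add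
      (tendsto_finsetSum _ fun i _ => (hm i).mul (hD (hh i) d))).add
      (tendsto_finsetSum _ fun i _ => (hγ i).mul_const (d i))
  · exact ge_of_tendsto' (hl i) fun k => (hFJ k).2.1 i
  · exact tendsto_nhds_unique ((hl i).mul (((hg i).continuous.tendsto x₀).comp hx))
      (tendsto_const_nhds.congr fun k => ((hFJ k).2.2.1 i).symm)
  · refine tendsto_nhds_unique (hγ i) (tendsto_const_nhds.congr' ?_)
    filter_upwards [(hx.apply_nhds i).eventually_ne hi] with k hk
    exact ((hFJ k).2.2.2 i hk).symm

/-- Under CC-MFCQ at the limit point, M-stationary multipliers along a convergent sequence are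
bounded. -/
theorem CCMFCQ.isBounded_range_mult {n m p : ℕ} {f : (Fin n → ℝ) → ℝ}
    {g : (Fin n → ℝ) → Fin m → ℝ} {h : (Fin n → ℝ) → Fin p → ℝ}
    (hf : ContDiff ℝ 1 f) (hg : ∀ i, ContDiff ℝ 1 (fun x => g x i))
    (hh : ∀ i, ContDiff ℝ 1 (fun x => h x i)) {x : ℕ → Fin n → ℝ} {x₀ : Fin n → ℝ}
    (hx₀ : CCMFCQ g h x₀) (hx : Tendsto x atTop (𝓝 x₀))
    {w : ℕ → (Fin m → ℝ) × (Fin p → ℝ) × (Fin n → ℝ)}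
    (hw : ∀ k, IsFritzJohnMult f g h (x k) 1 (w k)) : Bornology.IsBounded (Set.range w) := by
  suffices hb : IsBoundedUnder (· ≤ ·) atTop fun k => ‖w k‖ by
    obtain ⟨C, hC⟩ := hb.bddAbove_range
    exact isBounded_iff_forall_norm_le.2 ⟨C, by rintro _ ⟨k, rfl⟩; exact hC ⟨k, rfl⟩⟩
  by_contra hb
  have hfreq (N : ℕ) : ∃ᶠ k in atTop, (N : ℝ) < ‖w k‖ := fun hN =>
    hb (isBoundedUnder_of_eventually_le (a := (N : ℝ)) (hN.mono fun _ => not_lt.1))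
  obtain ⟨φ, hφ, hlt⟩ := extraction_forall_of_frequently hfreq
  have hpos (k) : 0 < ‖w (φ k)‖ := (Nat.cast_nonneg k).trans_lt (hlt k)
  have hinv : Tendsto (fun k => ‖w (φ k)‖⁻¹) atTop (𝓝 0) :=
    (tendsto_atTop_mono (fun k => (hlt k).le) tendsto_natCast_atTop_atTop).inv_tendsto_atTop
  have hsphere (k) : ‖w (φ k)‖⁻¹ • w (φ k) ∈
      Metric.sphere (0 : (Fin m → ℝ) × (Fin p → ℝ) × (Fin n → ℝ)) 1 := by
    rw [mem_sphere_zero_iff_norm, norm_smul, norm_inv, norm_norm, inv_mul_cancel₀ (hpos k).ne']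
  obtain ⟨w₀, hw₀, ψ, hψ, hlim⟩ := (isCompact_sphere _ _).tendsto_subseq hsphere
  have hFJ : IsFritzJohnMult f g h x₀ 0 w₀ :=
    .of_tendsto hf hg hh (hx.comp (hφ.comp hψ).tendsto_atTop) (hinv.comp hψ.tendsto_atTop) hlim
      fun k => by simpa using (hw (φ (ψ k))).smul (inv_nonneg.2 (hpos (ψ k)).le)
  rw [hx₀.eq_zero_of_isFritzJohnMult hFJ] at hw₀
  simp at hw₀

theorem stmt8
    {n m p : ℕ} (f : (Fin n → ℝ) → ℝ) (g : (Fin n → ℝ) → Fin m → ℝ)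
    (h : (Fin n → ℝ) → Fin p → ℝ) (κ : ℕ)
    (hn : 0 < n) (hm : 0 < m) (hp : 0 < p) (hκ0 : 0 < κ) (hκn : κ < n)
    (hf : ContDiff ℝ 1 f) (hg : ∀ i, ContDiff ℝ 1 (fun x => g x i))
    (hh : ∀ i, ContDiff ℝ 1 (fun x => h x i))
    (xs ys : Fin n → ℝ) (hZ : (xs, ys) ∈ ZSet g h κ)
    (z : ℕ → (Fin n → ℝ) × (Fin n → ℝ))
    (hzM : ∀ k, MStationary f g h κ (z k))
    (hconv : Tendsto z atTop (nhds (xs, ys)))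
    (hmfcq : CCMFCQ g h xs) :
    ∀ w : ℕ → (Fin m → ℝ) × (Fin p → ℝ) × (Fin n → ℝ),
      (∀ k, IsMMult f g h (z k).1 (w k).1 (w k).2.1 (w k).2.2) →
      Bornology.IsBounded (Set.range w) ∧
      ∀ (lam : Fin m → ℝ) (mu : Fin p → ℝ) (gam : Fin n → ℝ),
        (∃ φ : ℕ → ℕ, StrictMono φ ∧ Tendsto (w ∘ φ) atTop (nhds (lam, mu, gam))) →
        IsMMult f g h xs lam mu gam := by
  intro w hw
  have hFJ (k) : IsFritzJohnMult f g h (z k).1 1 (w k) := isFritzJohnMult_one_iff.2 (hw k)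
  refine ⟨hmfcq.isBounded_range_mult hf hg hh hconv.fst_nhds hFJ, ?_⟩
  rintro lam mu gam ⟨φ, hφ, hlim⟩
  exact isFritzJohnMult_one_iff.1 (.of_tendsto hf hg hh (hconv.fst_nhds.comp hφ.tendsto_atTop)
    tendsto_const_nhds hlim fun k => hFJ (φ k))
end
end

section
/- Local uniqueness of M-stationary points: Let f, g, h be twice continuously differentiable, let (x*, y*) be an M-stationary point of the continuous reformulation at which CC-CPLD holds, and assume d_xᵀ(∇²f(x*) + Σᵢ λᵢ∇²gᵢ(x*) + Σᵢ μᵢ∇²hᵢ(x*))d_x > 0 for all (d_x, d_y) ∈ C_Z(x*,y*) with d_x ≠ 0 and for ALL M-stationary multipliers (λ, μ, γ) of (x*, y*). Then there exists a radius r > 0 such that every M-stationary point (x, y) ∈ Z with ‖(x,y) − (x*,y*)‖ < r satisfies x = x*. -/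
open Set Filter Topology

noncomputable section

/-- Conic Carathéodory: a linear combination can be rewritten, without changing the sign of any
coefficient, so that the vectors with nonzero coefficient are linearly independent. -/
theorem exists_sum_eq_linearIndependent_support {ι V : Type*} [Fintype ι] [AddCommGroup V]
    [Module ℝ V] (v : ι → V) (c : ι → ℝ) :
    ∃ c' : ι → ℝ, ∑ i, c' i • v i = ∑ i, c i • v i ∧ (∀ i, 0 ≤ c i → 0 ≤ c' i) ∧
      (∀ i, c i = 0 → c' i = 0) ∧
      ∀ b : ι → ℝ, (∀ i, c' i = 0 → b i = 0) → ∑ i, b i • v i = 0 → b = 0 := by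
  classical
  let Q : ℕ → Prop := fun k => ∃ c' : ι → ℝ, ∑ i, c' i • v i = ∑ i, c i • v i ∧
    (∀ i, 0 ≤ c i → 0 ≤ c' i) ∧ (∀ i, c i = 0 → c' i = 0) ∧
    (Finset.univ.filter fun i => c' i ≠ 0).card = k
  have hQ : ∃ k, Q k := ⟨_, c, rfl, fun _ => id, fun _ => id, rfl⟩
  obtain ⟨c', hsum, hpos, hzero, hcard⟩ := Nat.find_spec hQ
  refine ⟨c', hsum, hpos, hzero, fun b hb hbsum => ?_⟩
  by_contra hne
  obtain ⟨j, hj⟩ := Function.ne_iff.1 hne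
  obtain ⟨k, hk, hmin⟩ := Finset.exists_min_image (Finset.univ.filter fun i => b i ≠ 0)
    (fun i => |c' i| / |b i|) ⟨j, by simpa using hj⟩
  have hbk : b k ≠ 0 := by simpa using hk
  have hle : ∀ i, |c' k / b k * b i| ≤ |c' i| := by
    intro i
    by_cases hbi : b i = 0
    · simp [hbi]
    · have := hmin i (by simpa using hbi)
      rw [abs_mul, abs_div]
      exact (le_div_iff₀ (abs_pos.2 hbi)).1 this
  refine Nat.find_min hQ (m := (Finset.univ.filter fun i => c' i - c' k / b k * b i ≠ 0).card) ?_
    ⟨fun i => c' i - c' k / b k * b i, ?_, ?_, ?_, rfl⟩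
  · rw [← hcard]
    apply Finset.card_lt_card
    refine Finset.ssubset_iff_subset_ne.2 ⟨fun i hi => ?_, fun heq => ?_⟩
    · simp only [Finset.mem_filter, Finset.mem_univ, true_and] at hi ⊢
      intro h0
      exact hi (by simp [h0, hb i h0])
    · have hk' : k ∈ Finset.univ.filter fun i => c' i ≠ 0 := by
        simpa using fun h0 => hbk (hb k h0)
      rw [← heq] at hk'
      simp [hbk] at hk'
  · simp only [sub_smul, mul_smul, Finset.sum_sub_distrib, ← Finset.smul_sum, hbsum, hsum]
    simp
  · intro i hi
    have h1 := hle i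
    rw [abs_of_nonneg (hpos i hi)] at h1
    linarith [le_abs_self (c' k / b k * b i)]
  · intro i hi
    have h0 := hzero i hi
    simp [h0, hb i h0]

/-- A bounded map into a proper space converges along an ultrafilter. -/
theorem Ultrafilter.exists_tendsto_of_eventually_mem {α X : Type*} [TopologicalSpace X]
    (U : Ultrafilter α) {K : Set X} (hK : IsCompact K) {u : α → X} (hu : ∀ᶠ a in U, u a ∈ K) :
    ∃ x ∈ K, Tendsto u U (𝓝 x) :=
  hK.ultrafilter_le_nhds (U.map u) (le_principal_iff.2 hu)

/-- Along an ultrafilter, multipliers with linearly independent active gradients converge if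
positive linear dependence at the limit point is inherited nearby. -/
theorem exists_tendsto_multipliers {ι E V : Type*} [Fintype ι] [TopologicalSpace E]
    [NormedAddCommGroup V] [NormedSpace ℝ V] {xs : E} (U : Ultrafilter E) (hU : ↑U ≤ 𝓝 xs)
    (w : E → V) (v : ι → E → V) (hw : ContinuousAt w xs) (hv : ∀ i, ContinuousAt (v i) xs)
    (P A : Set ι) (c : E → ι → ℝ)
    (hstat : ∀ᶠ x in U, w x + ∑ i, c x i • v i x = 0)
    (hP : ∀ᶠ x in U, ∀ i ∈ P, 0 ≤ c x i)
    (hA : ∀ᶠ x in U, ∀ i, c x i ≠ 0 → i ∈ A)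
    (hind : ∀ᶠ x in U, ∀ b : ι → ℝ, (∀ i, c x i = 0 → b i = 0) → ∑ i, b i • v i x = 0 → b = 0)
    (hcpld : ∀ I : Finset ι, (∀ i ∈ I, i ∈ A) →
      (∃ b : ι → ℝ, (∀ i ∈ P, 0 ≤ b i) ∧ (∀ i, i ∉ I → b i = 0) ∧ b ≠ 0 ∧
        ∑ i, b i • v i xs = 0) →
      ∀ᶠ x in 𝓝 xs, ∃ b : ι → ℝ, (∀ i, i ∉ I → b i = 0) ∧ b ≠ 0 ∧ ∑ i, b i • v i x = 0) :
    ∃ cs : ι → ℝ, Tendsto c U (𝓝 cs) := by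
  classical
  by_cases hb : ∃ R : ℝ, ∀ᶠ x in U, ‖c x‖ ≤ R
  · obtain ⟨R, hR⟩ := hb
    obtain ⟨cs, -, hcs⟩ := U.exists_tendsto_of_eventually_mem
      (isCompact_closedBall (0 : ι → ℝ) R) (u := c) (by simpa using hR)
    exact ⟨cs, hcs⟩
  exfalso
  push Not at hb
  have htop : Tendsto (fun x => ‖c x‖) U atTop := by
    refine tendsto_atTop.2 fun R => ?_
    exact (hb R).mono fun x hx => hx.le
  obtain ⟨I, hI⟩ := (U.map fun x => Finset.univ.filter fun i => c x i ≠ 0).eq_pure_of_finite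
  have hI' : ∀ᶠ x in U, (Finset.univ.filter fun i => c x i ≠ 0) = I := by
    have : ({I} : Set (Finset ι)) ∈ U.map fun x => Finset.univ.filter fun i => c x i ≠ 0 := by
      rw [hI]; exact mem_singleton I
    exact this
  obtain ⟨b, hbmem, hbt⟩ := U.exists_tendsto_of_eventually_mem
    (isCompact_sphere (0 : ι → ℝ) 1) (u := fun x => ‖c x‖⁻¹ • c x) (by
      filter_upwards [htop.eventually_gt_atTop 0] with x hx
      simp [norm_smul, hx.ne'])
  have hbi : ∀ i, Tendsto (fun x => ‖c x‖⁻¹ * c x i) U (𝓝 (b i)) := fun i =>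
    (tendsto_pi_nhds.1 hbt i)
  have hdep : ∑ i, b i • v i xs = 0 := by
    have h1 : Tendsto (fun x => ‖c x‖⁻¹ • w x + ∑ i, (‖c x‖⁻¹ * c x i) • v i x) U
        (𝓝 ((0 : ℝ) • w xs + ∑ i, b i • v i xs)) :=
      ((tendsto_inv_atTop_zero.comp htop).smul (hw.mono_left hU)).add
        (tendsto_finsetSum _ fun i _ => (hbi i).smul ((hv i).mono_left hU))
    have h2 : Tendsto (fun x => ‖c x‖⁻¹ • w x + ∑ i, (‖c x‖⁻¹ * c x i) • v i x) U (𝓝 0) := by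
      refine tendsto_const_nhds.congr' ?_
      filter_upwards [hstat] with x hx
      simp_rw [mul_smul, ← Finset.smul_sum, ← smul_add, hx, smul_zero]
    simpa using tendsto_nhds_unique h1 h2
  have hIA : ∀ i ∈ I, i ∈ A := by
    obtain ⟨x, hx, hxA⟩ := (hI'.and hA).exists
    intro i hi
    rw [← hx] at hi
    exact hxA i (by simpa using hi)
  have hev := hcpld I hIA ⟨b, fun i hi => ?_, fun i hi => ?_, ?_, hdep⟩
  · obtain ⟨x, ⟨b', hb'I, hb'0, hb's⟩, hxI, hx⟩ := ((hev.filter_mono hU).and (hI'.and hind)).exists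
    refine hb'0 (hx b' (fun i hi => hb'I i ?_) hb's)
    rw [← hxI]
    simpa using hi
  · refine ge_of_tendsto (hbi i) ?_
    filter_upwards [hP] with x hx
    exact mul_nonneg (inv_nonneg.2 (norm_nonneg _)) (hx i hi)
  · refine tendsto_nhds_unique (hbi i) (tendsto_const_nhds.congr' ?_)
    filter_upwards [hI'] with x hx
    rw [← hx] at hi
    have : c x i = 0 := by simpa using hi
    simp [this]
  · rintro rfl
    simp at hbmem

/-- If `ψ` is `C²` and `ψ x = ψ xs`, then `ψ'(xs)(x - xs)` is quadratically small. -/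
theorem ContDiff.exists_abs_fderiv_sub_le {E : Type*} [NormedAddCommGroup E] [NormedSpace ℝ E]
    {ψ : E → ℝ} (hψ : ContDiff ℝ 2 ψ) (xs : E) :
    ∃ C : ℝ, ∀ᶠ x in 𝓝 xs, ψ x = ψ xs → |fderiv ℝ ψ xs (x - xs)| ≤ C * ‖x - xs‖ ^ 2 := by
  have hd : DifferentiableAt ℝ (fderiv ℝ ψ) xs :=
    ((hψ.fderiv_right (m := 1) le_rfl).differentiable one_ne_zero) xs
  obtain ⟨C, hC⟩ := hd.isBigO_sub.bound
  obtain ⟨δ, hδ, hball⟩ := Metric.eventually_nhds_iff.1 hC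
  refine ⟨|C|, Metric.eventually_nhds_iff.2 ⟨δ, hδ, fun x hx heq => ?_⟩⟩
  have key := (convex_closedBall xs ‖x - xs‖).norm_image_sub_le_of_norm_fderiv_le' (𝕜 := ℝ)
    (f := ψ) (φ := fderiv ℝ ψ xs) (C := |C| * ‖x - xs‖) (x := xs) (y := x)
    (fun y _ => (hψ.differentiable two_ne_zero) y) (fun y hy => ?_)
    (Metric.mem_closedBall_self (norm_nonneg _)) (by simp [dist_eq_norm])
  · rw [heq, sub_self, zero_sub, norm_neg, Real.norm_eq_abs] at key
    linarith
  · have hy' : ‖y - xs‖ ≤ ‖x - xs‖ := by simpa [dist_eq_norm] using hy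
    calc ‖fderiv ℝ ψ y - fderiv ℝ ψ xs‖ ≤ C * ‖y - xs‖ :=
          hball (by rw [dist_eq_norm] at hx ⊢; exact hy'.trans_lt hx)
      _ ≤ |C| * ‖x - xs‖ := mul_le_mul (le_abs_self C) hy' (norm_nonneg _) (abs_nonneg C)

/-- Normalized increments of a differentiable map converge to the directional derivative along
the limit direction. -/
theorem HasFDerivAt.tendsto_inv_norm_smul {E F : Type*} [NormedAddCommGroup E] [NormedSpace ℝ E]
    [NormedAddCommGroup F] [NormedSpace ℝ F] {ψ : E → F} {ψ' : E →L[ℝ] F} {xs d : E}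
    (hψ : HasFDerivAt ψ ψ' xs) {l : Filter E} (hl : l ≤ 𝓝 xs)
    (hd : Tendsto (fun x => ‖x - xs‖⁻¹ • (x - xs)) l (𝓝 d)) :
    Tendsto (fun x => ‖x - xs‖⁻¹ • (ψ x - ψ xs)) l (𝓝 (ψ' d)) := by
  have h0 : Tendsto (fun x => x - xs) l (𝓝 0) := by
    have : Tendsto (fun x : E => x - xs) (𝓝 xs) (𝓝 (xs - xs)) :=
      (continuous_id.sub continuous_const).tendsto xs
    rw [sub_self] at this
    exact this.mono_left hl
  simpa using (hψ.hasFDerivWithinAt (s := univ)).lim h0 (by simp) hd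

/-- Along an ultrafilter of stationary points converging to `xs`, the multipliers and the
normalized directions converge, and the limit direction annihilates the second derivative of the
limiting Lagrangian. -/
theorem exists_limit_multipliers_direction {ι E : Type*} [Fintype ι] [NormedAddCommGroup E]
    [NormedSpace ℝ E] [FiniteDimensional ℝ E] {xs : E} (U : Ultrafilter E)
    (hU : ↑U ≤ 𝓝 xs) (hne : ∀ᶠ x in U, x ≠ xs) {f : E → ℝ} {φ : ι → E → ℝ}
    (hf : ContDiff ℝ 2 f) (hφ : ∀ i, ContDiff ℝ 2 (φ i)) (P : Set ι) (c : E → ι → ℝ)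
    (hstat : ∀ᶠ x in U, fderiv ℝ f x + ∑ i, c x i • fderiv ℝ (φ i) x = 0)
    (hP : ∀ᶠ x in U, ∀ i ∈ P, 0 ≤ c x i)
    (hact : ∀ᶠ x in U, ∀ i, c x i ≠ 0 → φ i x = 0)
    (hind : ∀ᶠ x in U, ∀ b : ι → ℝ, (∀ i, c x i = 0 → b i = 0) →
      ∑ i, b i • fderiv ℝ (φ i) x = 0 → b = 0)
    (hcpld : ∀ I : Finset ι, (∀ i ∈ I, φ i xs = 0) →
      (∃ b : ι → ℝ, (∀ i ∈ P, 0 ≤ b i) ∧ (∀ i, i ∉ I → b i = 0) ∧ b ≠ 0 ∧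
        ∑ i, b i • fderiv ℝ (φ i) xs = 0) →
      ∀ᶠ x in 𝓝 xs, ∃ b : ι → ℝ, (∀ i, i ∉ I → b i = 0) ∧ b ≠ 0 ∧
        ∑ i, b i • fderiv ℝ (φ i) x = 0) :
    ∃ (cs : ι → ℝ) (d : E), d ≠ 0 ∧ Tendsto (fun x => ‖x - xs‖⁻¹ • (x - xs)) U (𝓝 d) ∧
      fderiv ℝ f xs + ∑ i, cs i • fderiv ℝ (φ i) xs = 0 ∧ (∀ i ∈ P, 0 ≤ cs i) ∧
      (∀ i, cs i ≠ 0 → φ i xs = 0) ∧ fderiv ℝ f xs d = 0 ∧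
      fderiv ℝ (fderiv ℝ f) xs d d + ∑ i, cs i * fderiv ℝ (fderiv ℝ (φ i)) xs d d = 0 := by
  have hfd : ∀ {ψ : E → ℝ}, ContDiff ℝ 2 ψ → Differentiable ℝ (fderiv ℝ ψ) := fun hψ =>
    (hψ.fderiv_right (m := 1) le_rfl).differentiable one_ne_zero
  have hact' : ∀ᶠ x in U, ∀ i, c x i ≠ 0 → φ i xs = 0 := by
    have h1 : ∀ᶠ x in U, ∀ i, φ i xs ≠ 0 → φ i x ≠ 0 := by
      refine eventually_all.2 fun i => hU ?_
      by_cases hi : φ i xs = 0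
      · simp [hi]
      · filter_upwards [(hφ i).continuous.continuousAt.eventually_ne hi] with x hx _ using hx
    filter_upwards [hact, h1] with x hx hx1 i hi
    by_contra h0
    exact hx1 i h0 (hx i hi)
  obtain ⟨cs, hcs⟩ := exists_tendsto_multipliers U hU (fderiv ℝ f) (fun i => fderiv ℝ (φ i))
    (hfd hf xs).continuousAt (fun i => (hfd (hφ i) xs).continuousAt) P {i | φ i xs = 0} c
    hstat hP hact' hind hcpld
  have hci : ∀ i, Tendsto (fun x => c x i) U (𝓝 (cs i)) := tendsto_pi_nhds.1 hcs
  have hcne : ∀ i, cs i ≠ 0 → ∀ᶠ x in U, c x i ≠ 0 := fun i hi => (hci i).eventually_ne hi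
  obtain ⟨d, hdmem, hd⟩ := U.exists_tendsto_of_eventually_mem
    (isCompact_sphere (0 : E) 1) (u := fun x => ‖x - xs‖⁻¹ • (x - xs)) (by
      filter_upwards [hne] with x hx
      have : ‖x - xs‖ ≠ 0 := norm_ne_zero_iff.2 (sub_ne_zero.2 hx)
      simp [norm_smul, this])
  have hlim : fderiv ℝ f xs + ∑ i, cs i • fderiv ℝ (φ i) xs = 0 := by
    refine tendsto_nhds_unique (((hfd hf xs).continuousAt.mono_left hU).add
      (tendsto_finsetSum _ fun i _ => (hci i).smul ((hfd (hφ i) xs).continuousAt.mono_left hU)))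
      (tendsto_const_nhds.congr' ?_)
    filter_upwards [hstat] with x hx using hx.symm
  have hcsact : ∀ i, cs i ≠ 0 → φ i xs = 0 := fun i hi => by
    obtain ⟨x, hx, hx'⟩ := ((hcne i hi).and hact').exists
    exact hx' i hx
  have hdir : ∀ i, cs i ≠ 0 → fderiv ℝ (φ i) xs d = 0 := fun i hi => by
    refine tendsto_nhds_unique (((hφ i).differentiable two_ne_zero xs).hasFDerivAt
      |>.tendsto_inv_norm_smul hU hd) (tendsto_const_nhds.congr' ?_)
    filter_upwards [hcne i hi, hact] with x hx hx'
    simp [hx' i hx, hcsact i hi]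
  refine ⟨cs, d, ?_, hd, hlim, fun i hi => ?_, hcsact, ?_, ?_⟩
  · rintro rfl
    simp at hdmem
  · exact ge_of_tendsto (hci i) (hP.mono fun x hx => hx i hi)
  · have h1 := congrArg (fun L : E →L[ℝ] ℝ => L d) hlim
    have h2 : ∑ i, cs i * fderiv ℝ (φ i) xs d = 0 := Finset.sum_eq_zero fun i _ => by
      by_cases hi : cs i = 0
      · simp [hi]
      · simp [hdir i hi]
    simpa [sum_apply, h2] using h1
  · have hsecond : ∀ {ψ : E → ℝ}, ContDiff ℝ 2 ψ → Tendsto (fun x =>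
        (‖x - xs‖⁻¹ • (fderiv ℝ ψ x - fderiv ℝ ψ xs)) (‖x - xs‖⁻¹ • (x - xs))) U
        (𝓝 (fderiv ℝ (fderiv ℝ ψ) xs d d)) := fun hψ =>
      (isBoundedBilinearMap_apply.continuous.tendsto (_, d)).comp
        (((hfd hψ xs).hasFDerivAt.tendsto_inv_norm_smul hU hd).prodMk_nhds hd)
    have hrem : ∀ i, Tendsto (fun x => (c x i - cs i) *
        (‖x - xs‖⁻¹ * fderiv ℝ (φ i) xs (‖x - xs‖⁻¹ • (x - xs)))) U (𝓝 0) := fun i => by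
      obtain ⟨C, hC⟩ := (hφ i).exists_abs_fderiv_sub_le xs
      have h0 : Tendsto (fun x => |c x i - cs i| * |C|) U (𝓝 0) := by
        simpa using (((hci i).sub_const (cs i)).abs).mul_const |C|
      refine squeeze_zero_norm' ?_ h0
      have hzero : ∀ᶠ x in U, c x i = 0 → cs i = 0 := by
        by_cases hi : cs i = 0
        · simp [hi]
        · filter_upwards [hcne i hi] with x hx hx' using absurd hx' hx
      filter_upwards [hU hC, hact, hact', hne, hzero] with x hx hxa hxa' hxne hxz
      by_cases hxi : c x i = 0
      · simp [hxi, hxz hxi]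
      have hpos : 0 < ‖x - xs‖ := norm_pos_iff.2 (sub_ne_zero.2 hxne)
      have hq := hx (by rw [hxa i hxi, hxa' i hxi])
      rw [norm_mul, Real.norm_eq_abs]
      refine mul_le_mul_of_nonneg_left ?_ (abs_nonneg _)
      rw [map_smul, smul_eq_mul, Real.norm_eq_abs, abs_mul, abs_mul, abs_inv, abs_norm,
        ← mul_assoc, ← mul_inv, inv_mul_le_iff₀ (by positivity)]
      calc _ ≤ C * ‖x - xs‖ ^ 2 := hq
        _ ≤ |C| * ‖x - xs‖ ^ 2 := by gcongr; exact le_abs_self C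
        _ = _ := by ring
    have hsum := ((hsecond hf).add (tendsto_finsetSum Finset.univ fun i _ =>
      (hci i).mul (hsecond (hφ i)))).add (tendsto_finsetSum Finset.univ fun i _ => hrem i)
    simp only [Finset.sum_const_zero, add_zero] at hsum
    refine tendsto_nhds_unique hsum (tendsto_const_nhds.congr' ?_)
    filter_upwards [hstat] with x hx
    have h1 := congrArg (fun L : E →L[ℝ] ℝ => L (‖x - xs‖⁻¹ • (x - xs))) hx
    have h2 := congrArg (fun L : E →L[ℝ] ℝ => L (‖x - xs‖⁻¹ • (x - xs))) hlim
    simp only [add_apply, sum_apply,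
      smul_apply, zero_apply, smul_eq_mul,
      sub_apply] at h1 h2 ⊢
    generalize ‖x - xs‖⁻¹ • (x - xs) = e at *
    rw [add_assoc, ← Finset.sum_add_distrib]
    have h3 : ∀ i, c x i * (‖x - xs‖⁻¹ * (fderiv ℝ (φ i) x e - fderiv ℝ (φ i) xs e)) +
        (c x i - cs i) * (‖x - xs‖⁻¹ * fderiv ℝ (φ i) xs e) =
        ‖x - xs‖⁻¹ * (c x i * fderiv ℝ (φ i) x e - cs i * fderiv ℝ (φ i) xs e) := fun i => by ring
    simp_rw [h3, ← Finset.mul_sum, Finset.sum_sub_distrib]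
    linear_combination -‖x - xs‖⁻¹ * (h1 - h2)

/-- The constraint functions `gᵢ`, `hᵢ` and the coordinates, as one family. -/
def allConstraints {n m p : ℕ} (g : (Fin n → ℝ) → Fin m → ℝ) (h : (Fin n → ℝ) → Fin p → ℝ) :
    Fin m ⊕ Fin p ⊕ Fin n → (Fin n → ℝ) → ℝ
  | .inl i, x => g x i
  | .inr (.inl i), x => h x i
  | .inr (.inr i), x => x i

theorem contDiff_allConstraints {n m p : ℕ} {g : (Fin n → ℝ) → Fin m → ℝ}
    {h : (Fin n → ℝ) → Fin p → ℝ} (hg : ∀ i, ContDiff ℝ 2 (fun x => g x i))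
    (hh : ∀ i, ContDiff ℝ 2 (fun x => h x i)) : ∀ i, ContDiff ℝ 2 (allConstraints g h i)
  | .inl i => hg i
  | .inr (.inl i) => hh i
  | .inr (.inr i) => contDiff_apply ℝ ℝ i

theorem fderiv_coord {n : ℕ} (i : Fin n) (x : Fin n → ℝ) :
    fderiv ℝ (fun x : Fin n → ℝ => x i) x = ContinuousLinearMap.proj i :=
  (ContinuousLinearMap.proj (R := ℝ) (φ := fun _ : Fin n => ℝ) i).fderiv

theorem sum_smul_fderiv_allConstraints_apply {n m p : ℕ} (g : (Fin n → ℝ) → Fin m → ℝ)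
    (h : (Fin n → ℝ) → Fin p → ℝ) (c : Fin m ⊕ Fin p ⊕ Fin n → ℝ) (x d : Fin n → ℝ) :
    (∑ i, c i • fderiv ℝ (allConstraints g h i) x) d =
      ∑ i, c (.inl i) * D1 (fun x' => g x' i) x d +
        ∑ i, c (.inr (.inl i)) * D1 (fun x' => h x' i) x d + ∑ i, c (.inr (.inr i)) * d i := by
  have hc : ∀ i, fderiv ℝ (allConstraints g h (.inr (.inr i))) x =
    ContinuousLinearMap.proj i := fun i => fderiv_coord i x
  simp only [Fintype.sum_sum_type, add_apply, sum_apply,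
    smul_apply, smul_eq_mul, hc, ContinuousLinearMap.proj_apply, ← add_assoc]
  rfl

theorem combZero_iff {n m p : ℕ} (g : (Fin n → ℝ) → Fin m → ℝ) (h : (Fin n → ℝ) → Fin p → ℝ)
    (c : Fin m ⊕ Fin p ⊕ Fin n → ℝ) (x : Fin n → ℝ) :
    CombZero g h (fun i => c (.inl i)) (fun i => c (.inr (.inl i))) (fun i => c (.inr (.inr i))) x ↔
      ∑ i, c i • fderiv ℝ (allConstraints g h i) x = 0 := by
  rw [ContinuousLinearMap.ext_iff]
  simp only [sum_smul_fderiv_allConstraints_apply]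
  rfl

/-- An M-stationary multiplier, seen as a multiplier for `allConstraints`. -/
theorem isMMult_iff {n m p : ℕ} (f : (Fin n → ℝ) → ℝ) (g : (Fin n → ℝ) → Fin m → ℝ)
    (h : (Fin n → ℝ) → Fin p → ℝ) (c : Fin m ⊕ Fin p ⊕ Fin n → ℝ) (x : Fin n → ℝ)
    (hx : ∀ i, h x i = 0) :
    IsMMult f g h x (fun i => c (.inl i)) (fun i => c (.inr (.inl i)))
        (fun i => c (.inr (.inr i))) ↔
      fderiv ℝ f x + ∑ i, c i • fderiv ℝ (allConstraints g h i) x = 0 ∧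
      (∀ i ∈ range Sum.inl, 0 ≤ c i) ∧ ∀ i, c i ≠ 0 → allConstraints g h i x = 0 := by
  rw [ContinuousLinearMap.ext_iff]
  simp only [add_apply, sum_smul_fderiv_allConstraints_apply, IsMMult,
    forall_mem_range, Sum.forall, allConstraints, hx, implies_true, true_and, D1, ← add_assoc,
    zero_apply, mul_eq_zero, or_iff_not_imp_left]
  simp only [not_imp_comm, ne_eq]

theorem CCCPLD.allConstraints {n m p : ℕ} {g : (Fin n → ℝ) → Fin m → ℝ}
    {h : (Fin n → ℝ) → Fin p → ℝ} {x : Fin n → ℝ} (hx : CCCPLD g h x)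
    (I : Finset (Fin m ⊕ Fin p ⊕ Fin n)) (hI : ∀ i ∈ I, allConstraints g h i x = 0)
    (hdep : ∃ b : Fin m ⊕ Fin p ⊕ Fin n → ℝ, (∀ i ∈ range Sum.inl, 0 ≤ b i) ∧
      (∀ i, i ∉ I → b i = 0) ∧ b ≠ 0 ∧ ∑ i, b i • fderiv ℝ (allConstraints g h i) x = 0) :
    ∀ᶠ x' in 𝓝 x, ∃ b : Fin m ⊕ Fin p ⊕ Fin n → ℝ, (∀ i, i ∉ I → b i = 0) ∧ b ≠ 0 ∧
      ∑ i, b i • fderiv ℝ (_root_.allConstraints g h i) x' = 0 := by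
  obtain ⟨b, hpos, hsupp, hne, hsum⟩ := hdep
  have hev := hx (Finset.univ.filter fun i => .inl i ∈ I)
    (Finset.univ.filter fun i => .inr (.inl i) ∈ I)
    (Finset.univ.filter fun i => .inr (.inr i) ∈ I)
    (fun i hi => hI (.inl i) (by simpa using hi))
    (fun i hi => hI (.inr (.inr i)) (by simpa using hi))
    ⟨fun i => b (.inl i), fun i => b (.inr (.inl i)), fun i => b (.inr (.inr i)),
      fun i => hpos _ ⟨i, rfl⟩, fun i hi => hsupp _ (by simpa using hi),
      fun i hi => hsupp _ (by simpa using hi), fun i hi => hsupp _ (by simpa using hi),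
      fun ⟨h1, h2, h3⟩ => hne ?_, (combZero_iff g h b x).2 hsum⟩
  · filter_upwards [hev] with x' ⟨lam, mu, gam, hlam, hmu, hgam, hne', hcomb⟩
    refine ⟨Sum.elim lam (Sum.elim mu gam), ?_, fun h0 => hne' ⟨?_, ?_, ?_⟩,
      (combZero_iff g h (Sum.elim lam (Sum.elim mu gam)) x').1 hcomb⟩
    · rintro (i | i | i) hi
      · exact hlam i (by simpa using hi)
      · exact hmu i (by simpa using hi)
      · exact hgam i (by simpa using hi)
    · exact funext fun i => congrFun h0 (.inl i)
    · exact funext fun i => congrFun h0 (.inr (.inl i))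
    · exact funext fun i => congrFun h0 (.inr (.inr i))
  · funext i
    rcases i with i | i | i
    · exact congrFun h1 i
    · exact congrFun h2 i
    · exact congrFun h3 i

/-- An M-stationary multiplier can be chosen with linearly independent active gradients. -/
theorem IsMMult.exists_linearIndependent {n m p : ℕ} {f : (Fin n → ℝ) → ℝ}
    {g : (Fin n → ℝ) → Fin m → ℝ} {h : (Fin n → ℝ) → Fin p → ℝ} {x : Fin n → ℝ}
    {lam : Fin m → ℝ} {mu : Fin p → ℝ} {gam : Fin n → ℝ} (hM : IsMMult f g h x lam mu gam)
    (hx : ∀ i, h x i = 0) :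
    ∃ c : Fin m ⊕ Fin p ⊕ Fin n → ℝ,
      fderiv ℝ f x + ∑ i, c i • fderiv ℝ (allConstraints g h i) x = 0 ∧
      (∀ i ∈ range Sum.inl, 0 ≤ c i) ∧ (∀ i, c i ≠ 0 → allConstraints g h i x = 0) ∧
      ∀ b : Fin m ⊕ Fin p ⊕ Fin n → ℝ, (∀ i, c i = 0 → b i = 0) →
        ∑ i, b i • fderiv ℝ (allConstraints g h i) x = 0 → b = 0 := by
  obtain ⟨h1, h2, h3⟩ := (isMMult_iff f g h (Sum.elim lam (Sum.elim mu gam)) x hx).1 hM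
  obtain ⟨c, hsum, hpos, hzero, hind⟩ := exists_sum_eq_linearIndependent_support
    (fun i => fderiv ℝ (allConstraints g h i) x) (Sum.elim lam (Sum.elim mu gam))
  exact ⟨c, by rw [hsum, h1], fun i hi => hpos i (h2 i hi), fun i hi => h3 i (mt (hzero i) hi),
    hind⟩

theorem stmt9
    {n m p : ℕ} (f : (Fin n → ℝ) → ℝ) (g : (Fin n → ℝ) → Fin m → ℝ)
    (h : (Fin n → ℝ) → Fin p → ℝ) (κ : ℕ)
    (hn : 0 < n) (hm : 0 < m) (hp : 0 < p) (hκ0 : 0 < κ) (hκn : κ < n)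
    (hf : ContDiff ℝ 2 f) (hg : ∀ i, ContDiff ℝ 2 (fun x => g x i))
    (hh : ∀ i, ContDiff ℝ 2 (fun x => h x i))
    (xs ys : Fin n → ℝ) (hM : MStationary f g h κ (xs, ys)) (hcpld : CCCPLD g h xs)
    (hsoc : ∀ (lam : Fin m → ℝ) (mu : Fin p → ℝ) (gam : Fin n → ℝ),
      IsMMult f g h xs lam mu gam →
      ∀ dx dy : Fin n → ℝ, CritCone f g h κ xs ys dx dy → dx ≠ 0 →
        0 < D2 f xs dx + ∑ i, lam i * D2 (fun x' => g x' i) xs dx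
        + ∑ i, mu i * D2 (fun x' => h x' i) xs dx) :
    ∃ r > (0 : ℝ), ∀ z ∈ ZSet g h κ, dist z (xs, ys) < r →
      MStationary f g h κ z → z.1 = xs := by
  obtain ⟨⟨hgs, hhs, hy0, -, -, hxy⟩, -⟩ := hM
  simp only at hgs hhs hy0 hxy
  let S : Set (Fin n → ℝ) := {x | (∀ i, g x i ≤ 0) ∧ (∀ i, h x i = 0) ∧
    (∀ i, 0 < ys i → x i = 0) ∧ ∃ lam mu gam, IsMMult f g h x lam mu gam}
  suffices hS : ∀ᶠ x in 𝓝 xs, x ∈ S → x = xs by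
    have hy : ∀ᶠ z in 𝓝 (xs, ys), ∀ i, 0 < ys i → 0 < z.2 i := by
      refine eventually_all.2 fun i => ?_
      by_cases hi : 0 < ys i
      · have hc : ContinuousAt (fun z : (Fin n → ℝ) × (Fin n → ℝ) => z.2 i) (xs, ys) := by
          fun_prop
        filter_upwards [hc.eventually (lt_mem_nhds hi)] with z hz _ using hz
      · simp [hi]
    obtain ⟨r, hr, hball⟩ := Metric.eventually_nhds_iff.1
      (hy.and (continuousAt_fst.eventually hS))
    refine ⟨r, hr, fun z hz hdist hMz => ?_⟩
    obtain ⟨hzy, hzS⟩ := hball hdist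
    refine hzS ⟨hz.1, hz.2.1, fun i hi => ?_, hMz.2⟩
    exact (mul_eq_zero.1 (hz.2.2.2.2.2 i)).resolve_right (hzy i hi).ne'
  by_contra hcon
  have hfreq : ∃ᶠ x in 𝓝 xs, x ∈ S ∧ x ≠ xs := by
    exact (not_eventually.1 hcon).mono fun x hx => Classical.not_imp.1 hx
  have : NeBot (𝓝 xs ⊓ 𝓟 {x | x ∈ S ∧ x ≠ xs}) := frequently_mem_iff_neBot.1 hfreq
  let U : Ultrafilter (Fin n → ℝ) := Ultrafilter.of (𝓝 xs ⊓ 𝓟 {x | x ∈ S ∧ x ≠ xs})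
  have hUle : ↑U ≤ 𝓝 xs ⊓ 𝓟 {x | x ∈ S ∧ x ≠ xs} := Ultrafilter.of_le _
  have hU : ↑U ≤ 𝓝 xs := hUle.trans inf_le_left
  have hUS : ∀ᶠ x in U, x ∈ S ∧ x ≠ xs := le_principal_iff.1 (hUle.trans inf_le_right)
  have hmult : ∀ x, ∃ c : Fin m ⊕ Fin p ⊕ Fin n → ℝ, x ∈ S →
      fderiv ℝ f x + ∑ i, c i • fderiv ℝ (allConstraints g h i) x = 0 ∧
      (∀ i ∈ range Sum.inl, 0 ≤ c i) ∧ (∀ i, c i ≠ 0 → allConstraints g h i x = 0) ∧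
      ∀ b : Fin m ⊕ Fin p ⊕ Fin n → ℝ, (∀ i, c i = 0 → b i = 0) →
        ∑ i, b i • fderiv ℝ (allConstraints g h i) x = 0 → b = 0 := fun x => by
    by_cases hx : x ∈ S
    · obtain ⟨-, hhx, -, lam, mu, gam, hmul⟩ := hx
      obtain ⟨c, hc⟩ := hmul.exists_linearIndependent hhx
      exact ⟨c, fun _ => hc⟩
    · exact ⟨0, fun h => absurd h hx⟩
  choose c hc using hmult
  obtain ⟨cs, d, hd0, hd, hstat, hpos, hact, hfd, hquad⟩ :=
    exists_limit_multipliers_direction U hU (hUS.mono fun x hx => hx.2) hf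
      (contDiff_allConstraints hg hh) (range Sum.inl) c
      (hUS.mono fun x hx => (hc x hx.1).1) (hUS.mono fun x hx => (hc x hx.1).2.1)
      (hUS.mono fun x hx => (hc x hx.1).2.2.1) (hUS.mono fun x hx => (hc x hx.1).2.2.2)
      hcpld.allConstraints
  have hslope : ∀ {ψ : (Fin n → ℝ) → ℝ}, ContDiff ℝ 2 ψ →
      Tendsto (fun x => ‖x - xs‖⁻¹ • (ψ x - ψ xs)) U (𝓝 (fderiv ℝ ψ xs d)) := fun hψ =>
    (hψ.differentiable two_ne_zero xs).hasFDerivAt.tendsto_inv_norm_smul hU hd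
  have hcrit : CritCone f g h κ xs ys d 0 := by
    refine ⟨⟨fun i hi => ?_, fun i => ?_, ?_, ?_, ?_, ?_, fun i _ hi => ?_, ?_⟩, hfd.le⟩
    · refine le_of_tendsto (hslope (hg i)) ?_
      filter_upwards [hUS] with x hx
      rw [hi, sub_zero]
      exact mul_nonpos_of_nonneg_of_nonpos (inv_nonneg.2 (norm_nonneg _)) (hx.1.1 i)
    · refine tendsto_nhds_unique (hslope (hh i)) (tendsto_const_nhds.congr' ?_)
      filter_upwards [hUS] with x hx
      simp [hhs i, hx.1.2.1 i]
    · simp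
    · simp
    · simp
    · simp
    · have hxi : xs i = 0 := (mul_eq_zero.1 (hxy i)).resolve_right hi.ne'
      refine tendsto_nhds_unique (tendsto_pi_nhds.1 hd i) (tendsto_const_nhds.congr' ?_)
      filter_upwards [hUS] with x hx
      simp [hxi, hx.1.2.2.1 i hi]
    · simp
  have hsecond := hsoc _ _ _ ((isMMult_iff f g h cs xs hhs).2 ⟨hstat, hpos, hact⟩) d 0 hcrit hd0
  have hcoord : ∀ i : Fin n, fderiv ℝ (fderiv ℝ (allConstraints g h (.inr (.inr i)))) xs = 0 := by
    intro i
    have : fderiv ℝ (allConstraints g h (.inr (.inr i))) =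
        fun _ => ContinuousLinearMap.proj i := funext fun x => fderiv_coord i x
    rw [this]
    simp
  simp only [D2, iteratedFDeriv_two_apply, Matrix.cons_val_zero, Matrix.cons_val_one] at hsecond
  simp only [Fintype.sum_sum_type, hcoord, zero_apply, mul_zero,
    Finset.sum_const_zero, add_zero, ← add_assoc] at hquad
  exact hsecond.ne' hquad
end
end

section
/- Let x* be a strict local minimum of the cardinality constrained problem (CCP). Then there exist r > 0 and T > 0 such that for every t ∈ (0, T] the regularized program NLP(t) has a local minimum (x^t, y^t) with ‖x^t − x*‖ < r. -/
open Set Filter Topology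

noncomputable section

/-- The indicator vector of the zero components of `x` sums to `n - ‖x‖₀`. -/
theorem sum_ite_eq_zero_eq_sub_card0 {n : ℕ} (x : Fin n → ℝ) :
    ∑ i, (if x i = 0 then (1 : ℝ) else 0) = (n : ℝ) - card0 x := by
  have hc : card0 x = (Finset.univ.filter fun i => ¬ x i = 0).card := by
    rw [card0, ← Set.ncard_coe_finset]
    simp
  have hadd := Finset.card_filter_add_card_filter_not (s := (Finset.univ : Finset (Fin n)))
    (fun i => x i = 0)
  rw [Finset.card_univ, Fintype.card_fin] at hadd
  rw [Finset.sum_boole, hc, eq_sub_iff_add_eq]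
  exact_mod_cast hadd

/-- The `x`-part of a feasible point of the continuous reformulation is feasible for CCP. -/
theorem CCPFeasible.of_mem_ZSet {n m p : ℕ} {g : (Fin n → ℝ) → Fin m → ℝ}
    {h : (Fin n → ℝ) → Fin p → ℝ} {κ : ℕ} {z : (Fin n → ℝ) × (Fin n → ℝ)}
    (hz : z ∈ ZSet g h κ) : CCPFeasible g h κ z.1 := by
  obtain ⟨hg, hh, -, hy1, hsum, hxy⟩ := hz
  refine ⟨hg, hh, ?_⟩
  have hle : ∑ i, z.2 i ≤ ∑ i, (if z.1 i = 0 then (1 : ℝ) else 0) := by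
    refine Finset.sum_le_sum fun i _ => ?_
    split_ifs with hi
    · exact hy1 i
    · exact ((mul_eq_zero.mp (hxy i)).resolve_left hi).le
  rw [sum_ite_eq_zero_eq_sub_card0] at hle
  exact_mod_cast (by linarith : (card0 z.1 : ℝ) ≤ κ)

/-- A point feasible for CCP lifts to a feasible point of the continuous reformulation. -/
theorem CCPFeasible.mem_ZSet {n m p : ℕ} {g : (Fin n → ℝ) → Fin m → ℝ}
    {h : (Fin n → ℝ) → Fin p → ℝ} {κ : ℕ} {x : Fin n → ℝ} (hx : CCPFeasible g h κ x) :
    (x, fun i => if x i = 0 then (1 : ℝ) else 0) ∈ ZSet g h κ := by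
  obtain ⟨hg, hh, hc⟩ := hx
  refine ⟨hg, hh, fun i => ?_, fun i => ?_, ?_, fun i => ?_⟩
  · dsimp only; split_ifs <;> norm_num
  · dsimp only; split_ifs <;> norm_num
  · have hc' : (card0 x : ℝ) ≤ κ := by exact_mod_cast hc
    dsimp only
    rw [sum_ite_eq_zero_eq_sub_card0]
    linarith
  · dsimp only; split_ifs with hi <;> simp [hi]

theorem mem_ZReg_iff {n m p : ℕ} {g : (Fin n → ℝ) → Fin m → ℝ} {h : (Fin n → ℝ) → Fin p → ℝ}
    {κ : ℕ} {t : ℝ} (ht : 0 ≤ t) {z : (Fin n → ℝ) × (Fin n → ℝ)} :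
    z ∈ ZReg g h κ t ↔ ((∀ i, g z.1 i ≤ 0) ∧ (∀ i, h z.1 i = 0) ∧ (∀ i, 0 ≤ z.2 i) ∧
      (∀ i, z.2 i ≤ 1) ∧ (n : ℝ) - κ ≤ ∑ i, z.2 i) ∧ ‖z.1 * z.2‖ ≤ t := by
  simp only [ZReg, Set.mem_ofPred_eq, pi_norm_le_iff_of_nonneg ht, Pi.mul_apply, Real.norm_eq_abs,
    abs_le, forall_and]
  tauto

theorem mem_ZSet_iff {n m p : ℕ} {g : (Fin n → ℝ) → Fin m → ℝ} {h : (Fin n → ℝ) → Fin p → ℝ}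
    {κ : ℕ} {z : (Fin n → ℝ) × (Fin n → ℝ)} :
    z ∈ ZSet g h κ ↔ ((∀ i, g z.1 i ≤ 0) ∧ (∀ i, h z.1 i = 0) ∧ (∀ i, 0 ≤ z.2 i) ∧
      (∀ i, z.2 i ≤ 1) ∧ (n : ℝ) - κ ≤ ∑ i, z.2 i) ∧ z.1 * z.2 = 0 := by
  simp only [ZSet, Set.mem_ofPred_eq, funext_iff, Pi.mul_apply, Pi.zero_apply]
  tauto

/-- The points with `x` in a closed ball satisfying all constraints of the continuous
reformulation except complementarity form a compact set. -/
theorem isCompact_relaxed_inter_closedBall {n m p : ℕ} {g : (Fin n → ℝ) → Fin m → ℝ}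
    {h : (Fin n → ℝ) → Fin p → ℝ} (hg : ∀ i, Continuous fun x => g x i)
    (hh : ∀ i, Continuous fun x => h x i) (κ : ℕ) (x : Fin n → ℝ) (ρ : ℝ) :
    IsCompact {z : (Fin n → ℝ) × (Fin n → ℝ) | ((∀ i, g z.1 i ≤ 0) ∧ (∀ i, h z.1 i = 0) ∧
      (∀ i, 0 ≤ z.2 i) ∧ (∀ i, z.2 i ≤ 1) ∧ (n : ℝ) - κ ≤ ∑ i, z.2 i) ∧ dist z.1 x ≤ ρ} := by
  refine ((isCompact_closedBall x ρ).prod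
    (isCompact_Icc (a := (0 : Fin n → ℝ)) (b := 1))).of_isClosed_subset ?_ ?_
  · simp only [Set.ofPred_and, Set.ofPred_forall]
    refine IsClosed.inter (IsClosed.inter ?_ (IsClosed.inter ?_ (IsClosed.inter ?_
      (IsClosed.inter ?_ ?_)))) ?_
    · exact isClosed_iInter fun i =>
        isClosed_le ((hg i).comp continuous_fst) continuous_const
    · exact isClosed_iInter fun i =>
        isClosed_eq ((hh i).comp continuous_fst) continuous_const
    · exact isClosed_iInter fun i => isClosed_le continuous_const (by fun_prop)
    · exact isClosed_iInter fun i => isClosed_le (by fun_prop) continuous_const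
    · exact isClosed_le continuous_const (by fun_prop)
    · exact isClosed_le (by fun_prop) continuous_const
  · rintro z ⟨⟨-, -, h0, h1, -⟩, hd⟩
    exact ⟨hd, h0, h1⟩

theorem stmt11
    {n m p : ℕ} (f : (Fin n → ℝ) → ℝ) (g : (Fin n → ℝ) → Fin m → ℝ)
    (h : (Fin n → ℝ) → Fin p → ℝ) (κ : ℕ)
    (hn : 0 < n) (hm : 0 < m) (hp : 0 < p) (hκ0 : 0 < κ) (hκn : κ < n)
    (hf : ContDiff ℝ 1 f) (hg : ∀ i, ContDiff ℝ 1 (fun x => g x i))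
    (hh : ∀ i, ContDiff ℝ 1 (fun x => h x i))
    (xs : Fin n → ℝ) (hmin : StrictLocalMinCCP f g h κ xs) :
    ∃ r > (0 : ℝ), ∃ T > (0 : ℝ), ∀ t : ℝ, 0 < t → t ≤ T →
      ∃ z : (Fin n → ℝ) × (Fin n → ℝ), LocalMinReg f g h κ t z ∧ dist z.1 xs < r := by
  obtain ⟨hfeas, R, hR, hstrict⟩ := hmin
  have hcompact := isCompact_relaxed_inter_closedBall (fun i => (hg i).continuous)
    (fun i => (hh i).continuous) κ xs (R / 2)
  have hxy : Continuous fun z : (Fin n → ℝ) × (Fin n → ℝ) => ‖z.1 * z.2‖ := by fun_prop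
  have hfc : Continuous fun z : (Fin n → ℝ) × (Fin n → ℝ) => f z.1 :=
    hf.continuous.comp continuous_fst
  have hbdry : IsClosed {z : (Fin n → ℝ) × (Fin n → ℝ) | dist z.1 xs = R / 2 ∧ f z.1 ≤ f xs} :=
    (isClosed_eq (by fun_prop) continuous_const).inter (isClosed_le hfc continuous_const)
  obtain ⟨δ, hδ, hδle⟩ := (hcompact.inter_right hbdry).exists_forall_le' hxy.continuousOn
    (a := 0) (by
      rintro z ⟨⟨hz, -⟩, hd, hfz⟩
      refine norm_pos_iff.mpr fun h0 => ?_
      have hzf := CCPFeasible.of_mem_ZSet (mem_ZSet_iff.mpr ⟨hz, h0⟩)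
      have hne : z.1 ≠ xs := dist_pos.mp (by linarith)
      exact (hstrict z.1 hzf (by linarith) hne).not_ge hfz)
  refine ⟨R / 2, half_pos hR, δ / 2, half_pos hδ, fun t ht htT => ?_⟩
  obtain ⟨hys, hys0⟩ := mem_ZSet_iff.mp hfeas.mem_ZSet
  have hmem := And.intro (And.intro hys ((dist_self xs).trans_le (half_pos hR).le))
    ((congrArg norm hys0).trans_le (norm_zero.trans_le ht.le))
  obtain ⟨z, ⟨⟨hz, hzd⟩, hzt⟩, hzmin⟩ :=
    (hcompact.inter_right (isClosed_le hxy (continuous_const (y := t)))).exists_isMinOn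
      ⟨_, hmem⟩ hfc.continuousOn
  rw [isMinOn_iff] at hzmin
  have hzxs : f z.1 ≤ f xs := hzmin _ hmem
  have hlt : dist z.1 xs < R / 2 := by
    refine hzd.lt_of_ne fun heq => ?_
    have h1 := hδle z ⟨⟨hz, hzd⟩, heq, hzxs⟩
    have h2 : ‖z.1 * z.2‖ ≤ t := hzt
    linarith
  refine ⟨z, ⟨(mem_ZReg_iff ht.le).mpr ⟨hz, hzt⟩, R / 2 - dist z.1 xs, sub_pos.mpr hlt,
    fun z' hz' hd => ?_⟩, hlt⟩
  obtain ⟨hz'1, hz't⟩ := (mem_ZReg_iff ht.le).mp hz'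
  refine hzmin z' ⟨⟨hz'1, ?_⟩, hz't⟩
  have h1 : dist z'.1 z.1 ≤ dist z' z := le_max_left _ _
  linarith [dist_triangle z'.1 z.1 xs]
end
end

section
/- Let (x*, y*) be a strict local minimum of the continuous reformulation with respect to x and assume ‖x*‖₀ = κ. Then there exist r > 0 and T > 0 such that for every t ∈ (0, T] the regularized program NLP(t) has a local minimum (x^t, y^t) with ‖x^t − x*‖ < r. -/
open Set Filter Topology

noncomputable section

/-- A feasible point whose `x`-part has at least `κ` nonzero components has `y`-part equal to the
indicator of the zero set of `x`. -/
lemma eq_indicator_of_mem_ZSet {n m p : ℕ} {g : (Fin n → ℝ) → Fin m → ℝ}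
    {h : (Fin n → ℝ) → Fin p → ℝ} {κ : ℕ} {z : (Fin n → ℝ) × (Fin n → ℝ)}
    (hz : z ∈ ZSet g h κ) {xs : Fin n → ℝ} (hcard : card0 xs = κ)
    (hsupp : ∀ i, xs i ≠ 0 → z.1 i ≠ 0) :
    z.2 = fun i => if xs i = 0 then 1 else 0 := by
  obtain ⟨-, -, -, hy1, hsum, hxy⟩ := hz
  have hle : ∀ i ∈ Finset.univ, z.2 i ≤ if xs i = 0 then (1 : ℝ) else 0 := by
    intro i _
    split_ifs with hi
    · exact hy1 i
    · exact ((mul_eq_zero.mp (hxy i)).resolve_left (hsupp i hi)).le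
  have hcount : (∑ i, if xs i = 0 then (1 : ℝ) else 0) = (n : ℝ) - κ := by
    have h1 : (∑ i, if xs i ≠ 0 then (1 : ℝ) else 0) = κ := by
      rw [Finset.sum_boole, ← hcard, card0, Set.ncard_eq_toFinset_card']
      congr 2
      ext i
      simp
    have h2 : (∑ i, ((if xs i = 0 then (1 : ℝ) else 0) + if xs i ≠ 0 then (1 : ℝ) else 0))
        = n := by
      rw [Finset.sum_congr rfl (g := fun _ => (1 : ℝ)) (fun i _ => by split_ifs <;> simp_all)]
      simp
    rw [Finset.sum_add_distrib, h1] at h2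
    linarith
  have heq := (Finset.sum_eq_sum_iff_of_le hle).mp
    (le_antisymm (Finset.sum_le_sum hle) (hcount.le.trans hsum))
  exact funext fun i => heq i (Finset.mem_univ i)

/-- The constraints shared by `Z` and all `Z(t)` define a compact set once `x` is confined to a
closed ball. -/
lemma isCompact_common_constraints {n m p : ℕ} {g : (Fin n → ℝ) → Fin m → ℝ}
    {h : (Fin n → ℝ) → Fin p → ℝ} (hg : ∀ i, Continuous fun x => g x i)
    (hh : ∀ i, Continuous fun x => h x i) (κ : ℕ) (xs : Fin n → ℝ) (δ : ℝ) :
    IsCompact {z : (Fin n → ℝ) × (Fin n → ℝ) | dist z.1 xs ≤ δ ∧ (∀ i, g z.1 i ≤ 0) ∧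
      (∀ i, h z.1 i = 0) ∧ (∀ i, 0 ≤ z.2 i) ∧ (∀ i, z.2 i ≤ 1) ∧
      (n : ℝ) - (κ : ℝ) ≤ ∑ i, z.2 i} := by
  refine ((isCompact_closedBall xs δ).prod
    (isCompact_Icc (a := (0 : Fin n → ℝ)) (b := 1))).of_isClosed_subset ?_ ?_
  · simp only [Set.ofPred_and, Set.ofPred_forall]
    refine (isClosed_le (by fun_prop) continuous_const).inter <|
      (isClosed_iInter fun i => isClosed_le ((hg i).comp continuous_fst) continuous_const).inter <|
      (isClosed_iInter fun i => isClosed_eq ((hh i).comp continuous_fst) continuous_const).inter <|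
      (isClosed_iInter fun i => isClosed_le continuous_const (by fun_prop)).inter <|
      (isClosed_iInter fun i => isClosed_le (by fun_prop) continuous_const).inter <|
      isClosed_le continuous_const (by fun_prop)
  · rintro z ⟨hd, -, -, h0, h1, -⟩
    exact ⟨hd, h0, h1⟩

theorem stmt12
    {n m p : ℕ} (f : (Fin n → ℝ) → ℝ) (g : (Fin n → ℝ) → Fin m → ℝ)
    (h : (Fin n → ℝ) → Fin p → ℝ) (κ : ℕ)
    (hn : 0 < n) (hm : 0 < m) (hp : 0 < p) (hκ0 : 0 < κ) (hκn : κ < n)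
    (hf : ContDiff ℝ 1 f) (hg : ∀ i, ContDiff ℝ 1 (fun x => g x i))
    (hh : ∀ i, ContDiff ℝ 1 (fun x => h x i))
    (xs ys : Fin n → ℝ) (hmin : StrictLocalMinX f g h κ (xs, ys))
    (hcard : card0 xs = κ) :
    ∃ r > (0 : ℝ), ∃ T > (0 : ℝ), ∀ t : ℝ, 0 < t → t ≤ T →
      ∃ z : (Fin n → ℝ) × (Fin n → ℝ), LocalMinReg f g h κ t z ∧ dist z.1 xs < r := by
  obtain ⟨hZ, r, hr, hstrict⟩ := hmin
  obtain ⟨δ, hδ, hδr, hδx⟩ : ∃ δ > (0 : ℝ), δ < r ∧ ∀ i, xs i ≠ 0 → δ < |xs i| := by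
    have hev : ∀ᶠ δ in 𝓝[>] (0 : ℝ), δ < r ∧ ∀ i, xs i ≠ 0 → δ < |xs i| := by
      refine nhdsWithin_le_nhds ((eventually_lt_nhds hr).and (eventually_all.mpr fun i => ?_))
      by_cases hi : xs i = 0
      · simp [hi]
      · filter_upwards [eventually_lt_nhds (abs_pos.mpr hi)] with δ hδ _ using hδ
    obtain ⟨δ, hδ, hpos⟩ := (hev.and self_mem_nhdsWithin).exists
    exact ⟨δ, hpos, hδ⟩
  have hC := isCompact_common_constraints (fun i => (hg i).continuous)
    (fun i => (hh i).continuous) κ xs δ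
  set C := {z : (Fin n → ℝ) × (Fin n → ℝ) | dist z.1 xs ≤ δ ∧ (∀ i, g z.1 i ≤ 0) ∧
      (∀ i, h z.1 i = 0) ∧ (∀ i, 0 ≤ z.2 i) ∧ (∀ i, z.2 i ≤ 1) ∧
      (n : ℝ) - (κ : ℝ) ≤ ∑ i, z.2 i}
  have hfc := hf.continuous
  have hA : IsCompact (C ∩ {z | δ ≤ dist z.1 xs ∧ f z.1 ≤ f xs}) := by
    refine hC.inter_right ?_
    simp only [Set.ofPred_and]
    exact (isClosed_le continuous_const (by fun_prop)).inter
      (isClosed_le (by fun_prop) continuous_const)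
  have hys := eq_indicator_of_mem_ZSet hZ hcard (fun _ hi => hi)
  have hpos : ∀ z ∈ C ∩ {z | δ ≤ dist z.1 xs ∧ f z.1 ≤ f xs}, 0 < ‖z.1 * z.2‖ := by
    rintro z ⟨⟨hd, h1, h2, h3, h4, h5⟩, hd', hfz⟩
    rw [norm_pos_iff]
    intro h0
    have hzZ : z ∈ ZSet g h κ := ⟨h1, h2, h3, h4, h5, fun i => congrFun h0 i⟩
    have hz2 := eq_indicator_of_mem_ZSet hzZ hcard fun i hi hzi => by
      have := (dist_le_pi_dist z.1 xs i).trans hd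
      rw [hzi, Real.dist_eq, zero_sub, abs_neg] at this
      exact (hδx i hi).not_ge this
    have hdist : dist z (xs, ys) < r := by
      rw [Prod.dist_eq, hz2.trans hys.symm, dist_self]
      exact max_lt (hd.trans_lt hδr) hr
    refine (hstrict z hzZ hdist ?_).not_ge hfz
    intro hx
    rw [show z.1 = xs from hx, dist_self] at hd'
    exact hd'.not_gt hδ
  obtain ⟨c, hc, hcA⟩ := hA.exists_forall_le' (f := fun z => ‖z.1 * z.2‖)
    (by fun_prop) hpos
  refine ⟨δ, hδ, c / 2, half_pos hc, fun t ht htT => ?_⟩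
  have hK : IsCompact (C ∩ {z | (∀ i, z.1 i * z.2 i ≤ t) ∧ ∀ i, -t ≤ z.1 i * z.2 i}) := by
    refine hC.inter_right ?_
    simp only [Set.ofPred_and, Set.ofPred_forall]
    exact (isClosed_iInter fun i => isClosed_le (by fun_prop) continuous_const).inter
      (isClosed_iInter fun i => isClosed_le continuous_const (by fun_prop))
  have hsK : (xs, ys) ∈ C ∩ {z | (∀ i, z.1 i * z.2 i ≤ t) ∧ ∀ i, -t ≤ z.1 i * z.2 i} := by
    obtain ⟨h1, h2, h3, h4, h5, h6⟩ := hZ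
    refine ⟨⟨by simpa using hδ.le, h1, h2, h3, h4, h5⟩, fun i => ?_, fun i => ?_⟩ <;>
      rw [h6 i] <;> linarith
  obtain ⟨z, ⟨hzC, hzt⟩, hzmin⟩ := hK.exists_isMinOn (f := fun z => f z.1) ⟨_, hsK⟩
    (by fun_prop)
  have hlt : dist z.1 xs < δ := by
    by_contra! hge
    have h1 := hcA z ⟨hzC, hge, hzmin hsK⟩
    have h2 : ‖z.1 * z.2‖ ≤ t :=
      (pi_norm_le_iff_of_nonneg ht.le).mpr fun i => abs_le.mpr ⟨hzt.2 i, hzt.1 i⟩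
    linarith
  obtain ⟨-, h1, h2, h3, h4, h5⟩ := hzC
  refine ⟨z, ⟨⟨h1, h2, h3, h4, h5, hzt.1, hzt.2⟩, δ - dist z.1 xs, sub_pos.mpr hlt, ?_⟩, hlt⟩
  rintro z' ⟨k1, k2, k3, k4, k5, k6, k7⟩ hd
  refine hzmin ⟨⟨?_, k1, k2, k3, k4, k5⟩, k6, k7⟩
  have hfst : dist z'.1 z.1 ≤ dist z' z := le_max_left _ _
  linarith [dist_triangle z'.1 z.1 xs]
end
end
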